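/- arXiv:hep-th/0307112 — 9 statements merged into one kernel-verified Lean document; each statement's English description precedes it below -/
import Mathlib

section
/- Let k be a commutative ring, A an associative k-algebra, and R : A → A an idempotent k-linear map. Define the associated Hilbert transform U = 2R − id (equivalently U = R₊ − R₋ where R₊ = R and R₋ = id − R). Then R satisfies the Baxter identity R(x)·R(y) + R(x·y) = R(R(x)·y) + R(x·R(y)) for all x, y ∈ A if and only if U satisfies the Poincaré–Bertrand identity U(x)·U(y) + x·y = U(U(x)·y + x·U(y)) for all x, y ∈ A. -/
/-- The defect of the Poincaré–Bertrand identity for `2R - id` is four times the defect of the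
Baxter identity for `R`. -/
theorem poincareBertrand_defect_eq_four_nsmul {k A : Type*} [CommRing k]
    [NonUnitalRing A] [Module k A] (R U : A →ₗ[k] A)
    (hU : ∀ x : A, U x = 2 • R x - x) (x y : A) :
    U x * U y + x * y - U (U x * y + x * U y) =
      4 • (R x * R y + R (x * y) - (R (R x * y) + R (x * R y))) := by
  simp only [hU, two_nsmul, sub_mul, mul_sub, add_mul, mul_add, map_add, map_sub]
  abel

/-- Multiplication by four is injective on a module over a ring in which two is invertible. -/
theorem four_nsmul_eq_zero_iff_of_invertible_two (k : Type*) {M : Type*} [CommRing k]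
    [Invertible (2 : k)] [AddCommGroup M] [Module k M] (z : M) : 4 • z = 0 ↔ z = 0 := by
  have h : 4 • z = (2 : k) • (2 : k) • z := by
    rw [smul_smul, ← Nat.cast_smul_eq_nsmul k]
    norm_num
  have h2 : IsUnit (2 : k) := isUnit_of_invertible 2
  rw [h, h2.smul_eq_zero, h2.smul_eq_zero]


/-- For an idempotent k-linear map `R` on an associative k-algebra `A` (with 2 invertible
in `k`), `R` satisfies the Baxter identity iff the associated Hilbert transform
`U = 2R − id` satisfies the Poincaré–Bertrand identity. -/
theorem baxter_iff_poincareBertrand {k A : Type*} [CommRing k] [Invertible (2 : k)]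
    [NonUnitalRing A] [Module k A] [SMulCommClass k A A] [IsScalarTower k A A]
    (R : A →ₗ[k] A)
    (hIdem : ∀ x : A, R (R x) = R x)
    (U : A →ₗ[k] A)
    (hU : ∀ x : A, U x = 2 • R x - x) :
    (∀ x y : A, R x * R y + R (x * y) = R (R x * y) + R (x * R y)) ↔
    (∀ x y : A, U x * U y + x * y = U (U x * y + x * U y)) := by
  refine forall₂_congr fun x y => ?_
  rw [← sub_eq_zero, ← sub_eq_zero (a := U x * U y + x * y),
    poincareBertrand_defect_eq_four_nsmul R U hU,
    four_nsmul_eq_zero_iff_of_invertible_two k]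
end

section
/- Let k be a commutative ring, A an associative k-algebra, and R : A → A a Wiener–Hopf operator (idempotent k-linear map satisfying the Baxter identity). Let U = 2R − id be the associated Hilbert transform. Then the twisted multiplication m_U(x, y) = U(x)·y + x·U(y) is associative: m_U(m_U(x, y), z) = m_U(x, m_U(y, z)) for all x, y, z ∈ A. -/
/-- For a Wiener–Hopf operator `R` (idempotent k-linear map satisfying the Baxter
identity) with Hilbert transform `U = 2R − id`, the twisted multiplication
`m_U(x, y) = U(x)·y + x·U(y)` is associative. -/
theorem twistedMul_assoc {k A : Type*} [CommRing k] [NonUnitalRing A]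
    [Module k A] [SMulCommClass k A A] [IsScalarTower k A A]
    (R : A →ₗ[k] A)
    (hIdem : ∀ x : A, R (R x) = R x)
    (hBaxter : ∀ x y : A, R x * R y + R (x * y) = R (R x * y) + R (x * R y))
    (U : A →ₗ[k] A)
    (hU : ∀ x : A, U x = 2 • R x - x)
    (mU : A → A → A)
    (hmU : ∀ x y : A, mU x y = U x * y + x * U y) :
    ∀ x y z : A, mU (mU x y) z = mU x (mU y z) := by
  have key : ∀ x y : A, U (mU x y) = U x * U y + x * y := by
    intro x y
    have hR : R (mU x y) = 2 • (R x * R y) := by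
      have h : mU x y = 2 • (R x * y) + 2 • (x * R y) - 2 • (x * y) := by
        rw [hmU, hU, hU]
        noncomm_ring
      rw [h, map_sub, map_add, map_nsmul, map_nsmul, map_nsmul, ← smul_add, ← hBaxter]
      abel
    rw [hU (mU x y), hR, hmU, hU x, hU y]
    noncomm_ring
  intro x y z
  rw [hmU (mU x y) z, hmU x (mU y z), key, key, hmU, hmU]
  noncomm_ring
end

section
/- Let k be a commutative ring, A an associative k-algebra, and R : A → A a Wiener–Hopf operator (idempotent Baxter operator). Let U = 2R − id and equip A with the commutator bracket [x, y] = x·y − y·x. Then U satisfies the modified classical Yang–Baxter equation: [U(x), U(y)] − U([U(x), y] + [x, U(y)]) = −[x, y] for all x, y ∈ A. -/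
/-- The associative analogue of the modified Yang–Baxter equation for the Hilbert transform
`U = 2R − id` of a Baxter operator `R`. -/
theorem hilbertTransform_mul {A : Type*} [NonUnitalNonAssocRing A] (R U : A →+ A)
    (hBaxter : ∀ x y : A, R x * R y + R (x * y) = R (R x * y) + R (x * R y))
    (hU : ∀ x : A, U x = 2 • R x - x) (x y : A) :
    U x * U y - U (U x * y + x * U y) = -(x * y) := by
  have h := eq_sub_of_add_eq (hBaxter x y)
  simp only [hU, map_add, map_sub, sub_mul, mul_sub, two_nsmul, add_mul, mul_add, h]
  abel

/-- For a Wiener–Hopf operator `R` with Hilbert transform `U = 2R − id`, `U` satisfies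
the modified classical Yang–Baxter equation
`[Ux,Uy] − U([Ux,y] + [x,Uy]) = −[x,y]` with respect to the commutator bracket. -/
theorem hilbertTransform_mcybe {k A : Type*} [CommRing k] [NonUnitalRing A]
    [Module k A] [SMulCommClass k A A] [IsScalarTower k A A]
    (R : A →ₗ[k] A)
    (hIdem : ∀ x : A, R (R x) = R x)
    (hBaxter : ∀ x y : A, R x * R y + R (x * y) = R (R x * y) + R (x * R y))
    (U : A →ₗ[k] A)
    (hU : ∀ x : A, U x = 2 • R x - x) :
    ∀ x y : A,
      (U x * U y - U y * U x) - U ((U x * y - y * U x) + (x * U y - U y * x)) =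
        -(x * y - y * x) := by
  intro x y
  have h := hilbertTransform_mul R.toAddMonoidHom U.toAddMonoidHom hBaxter hU
  have hxy := h x y
  have hyx := h y x
  simp only [LinearMap.toAddMonoidHom_coe, map_add] at hxy hyx
  simp only [map_add, map_sub]
  calc
    _ = (U x * U y - (U (U x * y) + U (x * U y))) -
        (U y * U x - (U (U y * x) + U (y * U x))) := by abel
    _ = -(x * y - y * x) := by rw [hxy, hyx]; abel
end

section
/- Let k be a commutative ring, A an associative k-algebra, and R : A → A a Wiener–Hopf operator (idempotent Baxter operator). Let U = 2R − id and equip A with the commutator bracket [x, y] = x·y − y·x. Then the modified bracket [x, y]_U = [U(x), y] + [x, U(y)] satisfies the Jacobi identity: [[x, y]_U, z]_U + [[y, z]_U, x]_U + [[z, x]_U, y]_U = 0 for all x, y, z ∈ A; since it is bilinear and antisymmetric, [·,·]_U is a Lie bracket on A. -/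
/-- For a Wiener–Hopf operator `R` with Hilbert transform `U = 2R − id`, the modified
bracket `[x,y]_U = [Ux,y] + [x,Uy]` (commutator brackets) is antisymmetric and satisfies
the Jacobi identity, hence is a Lie bracket on `A`. -/
theorem modifiedBracket_lie {k A : Type*} [CommRing k] [NonUnitalRing A]
    [Module k A] [SMulCommClass k A A] [IsScalarTower k A A]
    (R : A →ₗ[k] A)
    (hIdem : ∀ x : A, R (R x) = R x)
    (hBaxter : ∀ x y : A, R x * R y + R (x * y) = R (R x * y) + R (x * R y))
    (U : A →ₗ[k] A)
    (hU : ∀ x : A, U x = 2 • R x - x)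
    (b : A → A → A)
    (hb : ∀ x y : A, b x y = (U x * y - y * U x) + (x * U y - U y * x)) :
    (∀ x y : A, b x y = -(b y x)) ∧
    (∀ x y z : A, b (b x y) z + b (b y z) x + b (b z x) y = 0) := by
  have hUmul (x y : A) : U (U x * y) + U (x * U y) = U x * U y + x * y := by
    have h : R (R x * y) = R x * R y + R (x * y) - R (x * R y) :=
      eq_sub_of_add_eq (hBaxter x y).symm
    simp only [hU, sub_mul, mul_sub, two_nsmul, add_mul, mul_add, map_add, map_sub, h]
    abel
  have hUb (x y : A) : U (b x y) = (U x * U y - U y * U x) + (x * y - y * x) := by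
    have hxy := eq_sub_of_add_eq (hUmul x y)
    have hyx := eq_sub_of_add_eq (hUmul y x)
    simp only [hb, map_add, map_sub, hxy, hyx]
    abel
  refine ⟨fun x y => ?_, fun x y z => ?_⟩
  · simp only [hb]
    abel
  · rw [hb (b x y), hb (b y z), hb (b z x)]
    simp only [hUb]
    simp only [hb]
    noncomm_ring
end

section
/- Let k be a commutative ring, A an associative k-algebra, and R : A → A a Wiener–Hopf operator (idempotent Baxter operator). Equip A with the commutator bracket [x, y] = x·y − y·x, giving a Lie algebra g. Then g₊ = range R and g₋ = ker R are Lie subalgebras of g (each closed under the commutator bracket), and g = g₊ ⊕ g₋ as k-modules: every x ∈ g decomposes uniquely as x = x₊ + x₋ with x₊ ∈ g₊, x₋ ∈ g₋. -/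
/-- The range of an idempotent Baxter operator is pointwise fixed under products. -/
theorem baxter_map_mul_of_idempotent {A : Type*} [NonUnitalRing A] (R : A → A)
    (hIdem : ∀ x : A, R (R x) = R x)
    (hBaxter : ∀ x y : A, R x * R y + R (x * y) = R (R x * y) + R (x * R y)) (x y : A) :
    R (R x * R y) = R x * R y := by
  have h := hBaxter (R x) (R y)
  rw [hIdem, hIdem] at h
  exact (add_right_cancel h).symm

/-- The kernel of a Baxter operator is closed under products. -/
theorem baxter_map_mul_eq_zero {A : Type*} [NonUnitalRing A] (R : A → A) (hzero : R 0 = 0)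
    (hBaxter : ∀ x y : A, R x * R y + R (x * y) = R (R x * y) + R (x * R y)) {x y : A}
    (hx : R x = 0) (hy : R y = 0) : R (x * y) = 0 := by
  simpa [hx, hy, hzero] using hBaxter x y

/-- For a Wiener–Hopf operator `R` on an associative k-algebra `A` (viewed as a Lie
algebra via the commutator bracket), `g₊ = range R` and `g₋ = ker R` are closed under
the commutator bracket, and every element of `A` decomposes uniquely as a sum of an
element of `g₊` and an element of `g₋`. -/
theorem wienerHopf_double_lie {k A : Type*} [CommRing k] [NonUnitalRing A]
    [Module k A] [SMulCommClass k A A] [IsScalarTower k A A]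
    (R : A →ₗ[k] A)
    (hIdem : ∀ x : A, R (R x) = R x)
    (hBaxter : ∀ x y : A, R x * R y + R (x * y) = R (R x * y) + R (x * R y)) :
    (∀ x ∈ LinearMap.range R, ∀ y ∈ LinearMap.range R,
        x * y - y * x ∈ LinearMap.range R) ∧
    (∀ x y : A, R x = 0 → R y = 0 → R (x * y - y * x) = 0) ∧
    (∀ x : A, ∃! p : A × A,
        p.1 ∈ LinearMap.range R ∧ p.2 ∈ LinearMap.ker R ∧ x = p.1 + p.2) := by
  refine ⟨?_, ?_, ?_⟩
  · rintro _ ⟨a, rfl⟩ _ ⟨b, rfl⟩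
    refine ⟨R a * R b - R b * R a, ?_⟩
    rw [map_sub, baxter_map_mul_of_idempotent R hIdem hBaxter,
      baxter_map_mul_of_idempotent R hIdem hBaxter]
  · intro x y hx hy
    rw [map_sub, baxter_map_mul_eq_zero R (map_zero R) hBaxter hx hy,
      baxter_map_mul_eq_zero R (map_zero R) hBaxter hy hx, sub_zero]
  · intro x
    refine ⟨(R x, x - R x), ⟨⟨x, rfl⟩, ?_, ?_⟩, ?_⟩
    · simp [hIdem]
    · simp
    · rintro ⟨_, q⟩ ⟨⟨a, rfl⟩, hq, rfl⟩
      have hq' : R q = 0 := hq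
      simp [hIdem, hq']
end

section
/- Let k be a commutative ring, H a k-coalgebra with comultiplication Δ and counit ε, and A an associative unital k-algebra. Equip Hom_k(H, A) with the convolution product f ⋆ g = m_A ∘ (f ⊗ g) ∘ Δ and unit e = η_A ∘ ε. If R : A → A is a k-linear map satisfying the Baxter identity on A, then the induced map R̂ : Hom_k(H, A) → Hom_k(H, A), R̂(f) = R ∘ f, satisfies the Baxter identity on the convolution algebra: R̂(f) ⋆ R̂(g) + R̂(f ⋆ g) = R̂(R̂(f) ⋆ g) + R̂(f ⋆ R̂(g)) for all f, g ∈ Hom_k(H, A). Moreover, if R is idempotent, then R̂ is idempotent, so R̂ is a Wiener–Hopf operator on the convolution algebra. -/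
open TensorProduct

/-- The convolution product `f ⋆ g = m_A ∘ (f ⊗ g) ∘ Δ` on `Hom_k(H, A)`, for a
k-coalgebra `H` and an associative unital k-algebra `A`. -/
noncomputable def convProd {k H A : Type*} [CommRing k]
    [AddCommGroup H] [Module k H] [Coalgebra k H] [Ring A] [Algebra k A]
    (f g : H →ₗ[k] A) : H →ₗ[k] A :=
  LinearMap.mul' k A ∘ₗ TensorProduct.map f g ∘ₗ Coalgebra.comul

/-- If `R : A → A` satisfies the Baxter identity, then post-composition with `R` on the
convolution algebra `Hom_k(H, A)` satisfies the Baxter identity for the convolution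
product; moreover, if `R` is idempotent then so is the induced map, so the induced map
is a Wiener–Hopf operator on the convolution algebra. -/
theorem convolution_baxter {k H A : Type*} [CommRing k]
    [AddCommGroup H] [Module k H] [Coalgebra k H] [Ring A] [Algebra k A]
    (R : A →ₗ[k] A)
    (hBaxter : ∀ x y : A, R x * R y + R (x * y) = R (R x * y) + R (x * R y)) :
    (∀ f g : H →ₗ[k] A,
      convProd (R ∘ₗ f) (R ∘ₗ g) + R ∘ₗ convProd f g =
        R ∘ₗ convProd (R ∘ₗ f) g + R ∘ₗ convProd f (R ∘ₗ g)) ∧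
    ((∀ x : A, R (R x) = R x) →
      ∀ f : H →ₗ[k] A, R ∘ₗ (R ∘ₗ f) = R ∘ₗ f) := by
  refine ⟨fun f g => LinearMap.ext fun x => ?_, fun hR f => LinearMap.ext fun x => hR (f x)⟩
  simp only [convProd, LinearMap.add_apply, LinearMap.comp_apply]
  induction (Coalgebra.comul x : H ⊗[k] H) with
  | zero => simp
  | tmul a b => simpa using hBaxter (f a) (g b)
  | add s t hs ht =>
    simp only [map_add]
    rw [add_add_add_comm, hs, ht, add_add_add_comm]
end

section
/- Let k be a commutative ring, B an associative unital k-algebra, and R : B → B a k-linear map satisfying the Baxter identity R(x)·R(y) + R(x·y) = R(R(x)·y) + R(x·R(y)). Set R₋ = id − R. Suppose a, x, y ∈ B satisfy the fixed-point equations x = 1 − R(x·a) and y = 1 − R₋(a·y). Then x·(1 + a)·y = 1. -/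
/-- Atkinson-type factorization: if `R` satisfies the Baxter identity on a unital
associative k-algebra `B`, `R₋ = id − R`, and `x, y` solve the fixed-point equations
`x = 1 − R(x·a)` and `y = 1 − R₋(a·y)`, then `x·(1 + a)·y = 1`. -/
theorem baxter_atkinson_factorization {k B : Type*} [CommRing k] [Ring B] [Algebra k B]
    (R : B →ₗ[k] B)
    (hBaxter : ∀ x y : B, R x * R y + R (x * y) = R (R x * y) + R (x * R y))
    (Rm : B →ₗ[k] B)
    (hRm : ∀ z : B, Rm z = z - R z)
    (a x y : B)
    (hx : x = 1 - R (x * a))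
    (hy : y = 1 - Rm (a * y)) :
    x * (1 + a) * y = 1 := by
  rw [hRm] at hy
  have huv : R (x * a) * (a * y) + x * a * R (a * y) - x * a * (a * y) = a * y - x * a := by
    have h₁ : x * a * y = a * y - R (x * a) * (a * y) := by
      calc x * a * y = x * (a * y) := mul_assoc x a y
        _ = (1 - R (x * a)) * (a * y) := congrArg (· * (a * y)) hx
        _ = a * y - R (x * a) * (a * y) := by rw [sub_mul, one_mul]
    have h₂ : x * a * y = x * a - x * a * (a * y) + x * a * R (a * y) := by
      calc x * a * y = x * a * (1 - (a * y - R (a * y))) := congrArg (x * a * ·) hy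
        _ = x * a - x * a * (a * y) + x * a * R (a * y) := by noncomm_ring
    calc R (x * a) * (a * y) + x * a * R (a * y) - x * a * (a * y)
        = x * a - x * a * (a * y) + x * a * R (a * y) + R (x * a) * (a * y) - x * a := by abel
      _ = a * y - x * a := by rw [← h₂, h₁, sub_add_cancel]
  have hR : R (x * a) * R (a * y) = R (a * y) - R (x * a) := by
    rw [← map_sub, ← huv, map_sub, map_add, ← hBaxter, add_sub_cancel_right]
  calc x * (1 + a) * y = x * (y + a * y) := by noncomm_ring
    _ = (1 - R (x * a)) * (1 + R (a * y)) := by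
      have hy' : y + a * y = 1 + R (a * y) := by
        rw [← sub_add, sub_add_eq_add_sub, eq_sub_iff_add_eq] at hy
        exact hy
      rw [hy', ← hx]
    _ = 1 + R (a * y) - R (x * a) - R (x * a) * R (a * y) := by noncomm_ring
    _ = 1 := by rw [hR]; abel
end

section
/- Let k be a commutative ring, H a k-coalgebra with comultiplication Δ and counit ε, and A an associative unital k-algebra carrying a Wiener–Hopf operator R (an idempotent k-linear map satisfying the Baxter identity). On the convolution algebra Hom_k(H, A) with product f ⋆ g = m_A ∘ (f ⊗ g) ∘ Δ and unit e = η_A ∘ ε, let R̂(f) = R ∘ f and R̂₋ = id − R̂. Let φ ∈ Hom_k(H, A) and set a = φ − e. If φ₋ and ψ in Hom_k(H, A) satisfy the fixed-point equations φ₋ = e − R̂(φ₋ ⋆ a) and ψ = e − R̂₋(a ⋆ ψ), then φ₋ ⋆ φ ⋆ ψ = e; that is, φ admits the Birkhoff-type factorization exhibited by φ₋ and ψ in the convolution algebra. -/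
open TensorProduct

/-- The convolution unit `e = η_A ∘ ε` of `Hom_k(H, A)`. -/
noncomputable def convUnit {k H A : Type*} [CommRing k]
    [AddCommGroup H] [Module k H] [Coalgebra k H] [Ring A] [Algebra k A] :
    H →ₗ[k] A :=
  Algebra.linearMap k A ∘ₗ Coalgebra.counit

open WithConv

/-- The Birkhoff factorization attached to an additive Baxter operator `P` on a ring:
idempotence of `P` is not needed. -/
theorem baxter_birkhoff_factorization {S : Type*} [Ring S] (P : S →+ S)
    (hP : ∀ x y : S, P x * P y + P (x * y) = P (P x * y) + P (x * P y))
    {p q a : S} (hp : p = 1 - P (p * a)) (hq : q = 1 - (a * q - P (a * q))) :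
    p * (1 + a) * q = 1 := by
  generalize hX : p * a = X at hp
  generalize hY : a * q = Y at hq
  have hXq : X * q = X - X * Y + X * P Y := by rw [hq]; noncomm_ring
  have hpY : X * q = Y - P X * Y := by
    calc X * q = p * Y := by rw [← hX, ← hY, mul_assoc]
      _ = Y - P X * Y := by rw [hp, sub_mul, one_mul]
  have hPP : P X * P Y = P Y - P X := by
    have h : P (X - X * Y + X * P Y) = P (Y - P X * Y) := by rw [← hXq, hpY]
    simp only [map_add, map_sub] at h
    have hB := eq_sub_of_add_eq (hP X Y)
    rw [hB, ← sub_eq_zero, ← sub_eq_zero.mpr h]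
    abel
  have hpq : p * q = 1 - P X - Y + P Y + P X * Y - P X * P Y := by
    rw [hp, hq]; noncomm_ring
  rw [mul_add, mul_one, hX, add_mul, hpq, hpY, hPP]
  abel

/-- Post-composition with a Baxter operator is a Baxter operator on the convolution algebra. -/
theorem comp_convMul_baxter {k H A : Type*} [CommRing k]
    [AddCommGroup H] [Module k H] [Coalgebra k H] [Ring A] [Algebra k A] (R : A →ₗ[k] A)
    (hR : ∀ x y : A, R x * R y + R (x * y) = R (R x * y) + R (x * R y))
    (f g : WithConv (H →ₗ[k] A)) :
    toConv (R ∘ₗ f.ofConv) * toConv (R ∘ₗ g.ofConv) + toConv (R ∘ₗ (f * g).ofConv) =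
      toConv (R ∘ₗ (toConv (R ∘ₗ f.ofConv) * g).ofConv) +
        toConv (R ∘ₗ (f * toConv (R ∘ₗ g.ofConv)).ofConv) := by
  ext x
  simp only [ofConv_add, LinearMap.add_apply, LinearMap.comp_apply,
    (Coalgebra.Repr.arbitrary k x).convMul_apply, map_sum, ← Finset.sum_add_distrib, hR]

/-- Birkhoff-type factorization in the convolution algebra: for a Wiener–Hopf operator
`R` on `A`, with `R̂(f) = R ∘ f` and `R̂₋ = id − R̂`, if `φ₋ = e − R̂(φ₋ ⋆ a)` and
`ψ = e − R̂₋(a ⋆ ψ)` where `a = φ − e`, then `φ₋ ⋆ φ ⋆ ψ = e`. -/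
theorem convolution_birkhoff_factorization {k H A : Type*} [CommRing k]
    [AddCommGroup H] [Module k H] [Coalgebra k H] [Ring A] [Algebra k A]
    (R : A →ₗ[k] A)
    (hIdem : ∀ x : A, R (R x) = R x)
    (hBaxter : ∀ x y : A, R x * R y + R (x * y) = R (R x * y) + R (x * R y))
    (φ φm ψ : H →ₗ[k] A)
    (a : H →ₗ[k] A) (ha : a = φ - convUnit)
    (hφm : φm = convUnit - R ∘ₗ convProd φm a)
    (hψ : ψ = convUnit - (convProd a ψ - R ∘ₗ convProd a ψ)) :
    convProd (convProd φm φ) ψ = convUnit := by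
  let P : WithConv (H →ₗ[k] A) →+ WithConv (H →ₗ[k] A) :=
    AddMonoidHom.mk' (fun f ↦ toConv (R ∘ₗ f.ofConv)) fun f g ↦ by simp [LinearMap.comp_add]
  have h := baxter_birkhoff_factorization P (comp_convMul_baxter R hBaxter)
    (p := toConv φm) (q := toConv ψ) (a := toConv a)
    (congrArg toConv hφm) (congrArg toConv hψ)
  have hφ : 1 + toConv a = toConv φ := by
    rw [ha, toConv_sub]
    exact add_sub_cancel _ _
  rw [hφ] at h
  exact congrArg ofConv h
end

section
/- Let k be a commutative ring, H a k-coalgebra with comultiplication Δ and counit ε, and A an associative unital k-algebra with an idempotent k-linear map R : A → A. On the convolution algebra Hom_k(H, A) with product f ⋆ g = m_A ∘ (f ⊗ g) ∘ Δ and unit e = η_A ∘ ε, let R̂(f) = R ∘ f and R̂₋ = id − R̂. Let φ ∈ Hom_k(H, A), a = φ − e, and suppose φ₋ satisfies the counterterm fixed-point equation φ₋ = e − R̂(φ₋ ⋆ a). Then the renormalized part φ₊ := φ₋ ⋆ φ satisfies φ₊ = e + R̂₋(φ₋ ⋆ a); consequently φ₋ − e lies in the range of R̂ (i.e. R̂(φ₋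 − e) = φ₋ − e) and φ₊ − e lies in the kernel of R̂ (i.e. R̂(φ₊ − e) = 0). -/
open TensorProduct

theorem convProd_sub {k H A : Type*} [CommRing k]
    [AddCommGroup H] [Module k H] [Coalgebra k H] [Ring A] [Algebra k A]
    (f g h : H →ₗ[k] A) : convProd f (g - h) = convProd f g - convProd f h := by
  have hmap : TensorProduct.map f (g - h) = TensorProduct.map f g - TensorProduct.map f h :=
    map_sub (TensorProduct.mapBilinear (RingHom.id k) H H A A f) g h
  rw [convProd, hmap, LinearMap.sub_comp, LinearMap.comp_sub, convProd, convProd]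

theorem convProd_convUnit {k H A : Type*} [CommRing k]
    [AddCommGroup H] [Module k H] [Coalgebra k H] [Ring A] [Algebra k A]
    (f : H →ₗ[k] A) : convProd f convUnit = f := by
  have hmap : TensorProduct.map f (convUnit : H →ₗ[k] A) =
      TensorProduct.map f (Algebra.linearMap k A) ∘ₗ
        LinearMap.lTensor H (Coalgebra.counit : H →ₗ[k] k) := by
    rw [LinearMap.map_comp_lTensor, convUnit]
  ext x
  rw [convProd, hmap, LinearMap.comp_apply, LinearMap.comp_apply, LinearMap.comp_apply,
    Coalgebra.lTensor_counit_comul]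
  simp

/-- If `R` is an idempotent k-linear map on `A`, `R̂(f) = R ∘ f`, `a = φ − e`, and the
counterterm `φ₋` satisfies `φ₋ = e − R̂(φ₋ ⋆ a)`, then the renormalized part
`φ₊ = φ₋ ⋆ φ` satisfies `φ₊ = e + R̂₋(φ₋ ⋆ a)`; consequently `φ₋ − e` lies in the range
of `R̂` (i.e. `R̂(φ₋ − e) = φ₋ − e`) and `φ₊ − e` lies in the kernel of `R̂`. -/
theorem counterterm_renormalized_parts {k H A : Type*} [CommRing k]
    [AddCommGroup H] [Module k H] [Coalgebra k H] [Ring A] [Algebra k A]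
    (R : A →ₗ[k] A)
    (hIdem : ∀ x : A, R (R x) = R x)
    (φ φm : H →ₗ[k] A)
    (a : H →ₗ[k] A) (ha : a = φ - convUnit)
    (hφm : φm = convUnit - R ∘ₗ convProd φm a)
    (φp : H →ₗ[k] A) (hφp : φp = convProd φm φ) :
    φp = convUnit + (convProd φm a - R ∘ₗ convProd φm a) ∧
    R ∘ₗ (φm - convUnit) = φm - convUnit ∧
    R ∘ₗ (φp - convUnit) = 0 := by
  have hp : φp = convUnit + (convProd φm a - R ∘ₗ convProd φm a) := by
    have hsub : convProd φm a = φp - φm := by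
      rw [hφp, ha, convProd_sub, convProd_convUnit]
    have hφp' : φp = φm + convProd φm a := by rw [hsub, add_sub_cancel]
    calc
      φp = φm + convProd φm a := hφp'
      _ = convUnit - R ∘ₗ convProd φm a + convProd φm a :=
        congrArg (· + convProd φm a) hφm
      _ = convUnit + (convProd φm a - R ∘ₗ convProd φm a) := by abel
  have hm : φm - convUnit = -(R ∘ₗ convProd φm a) := by
    rw [sub_eq_iff_eq_add, neg_add_eq_sub]
    exact hφm
  refine ⟨hp, ?_, ?_⟩
  · rw [hm]
    ext x
    simp [hIdem]
  · rw [hp, add_sub_cancel_left]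
    ext x
    simp [hIdem]
end
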